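/- Let n ≥ 2 and 1 ≤ k < n, and fix the disconnection penalty M > n². Then every stable wiring for the uniform (n,k)-BDNF game is strongly connected. -/

import Mathlib

namespace BDNF

variable {V : Type} [DecidableEq V]

/-- `connIn s m v u` : there is a directed path with at most `m` edges from `v`
to `u` in the directed graph defined by the wiring `s`. -/
def connIn (s : V → Finset V) : ℕ → V → V → Prop
  | 0, v, u => v = u
  | m + 1, v, u => v = u ∨ ∃ w ∈ s v, connIn s m w u

/-- Directed hop distance from `v` to `u`, with disconnection penalty `M`. -/
noncomputable def distW (s : V → Finset V) (M : ℕ) (v u : V) : ℕ := by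
  classical exact if h : ∃ m, connIn s m v u then Nat.find h else M

/-- Cost of node `v` in the uniform game: the sum of its distances to all
other nodes. -/
noncomputable def cost [Fintype V] (s : V → Finset V) (M : ℕ) (v : V) : ℕ :=
  ∑ u ∈ Finset.univ.filter (fun u => u ≠ v), distW s M v u

/-- `s` is a wiring with out-degree bound `k`: every node links to at most `k`
other nodes. -/
def IsWiring (k : ℕ) (s : V → Finset V) : Prop :=
  ∀ v, v ∉ s v ∧ (s v).card ≤ k

/-- `s` is stable (a pure Nash equilibrium) for the uniform game: no node can
strictly decrease its cost by rewiring its own out-links. -/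
def Stable [Fintype V] (k M : ℕ) (s : V → Finset V) : Prop :=
  ∀ (v : V) (t : Finset V), v ∉ t → t.card ≤ k →
    cost s M v ≤ cost (Function.update s v t) M v

/-- A wiring is strongly connected if every node has a directed path to every
other node. -/
def StronglyConnected (s : V → Finset V) : Prop :=
  ∀ v u : V, ∃ m : ℕ, connIn s m v u

/-- The reach of node `v`: the number of nodes (including `v` itself) to which
`v` has a directed path. -/
noncomputable def reach (s : V → Finset V) (v : V) : ℕ :=
  Nat.card {u : V // ∃ m : ℕ, connIn s m v u}

/-- `BRStep k M s v s'` : wiring `s'` is obtained from wiring `s` by node `v`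
executing a best-response step, i.e. `v` rewires its out-links to a set of at
most `k` other nodes minimizing its resulting cost (keeping its current links
if they are already optimal), while all other nodes keep their links. -/
def BRStep [Fintype V] (k M : ℕ) (s : V → Finset V) (v : V)
    (s' : V → Finset V) : Prop :=
  (∀ u : V, u ≠ v → s' u = s u) ∧ v ∉ s' v ∧ (s' v).card ≤ k ∧
    (∀ t : Finset V, v ∉ t → t.card ≤ k →
      cost s' M v ≤ cost (Function.update s v t) M v) ∧
    ((∀ t : Finset V, v ∉ t → t.card ≤ k →
      cost s M v ≤ cost (Function.update s v t) M v) → s' v = s v)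

open Relation

/-- `Reaches s v u` : there is a directed path from `v` to `u`. -/
def Reaches (s : V → Finset V) : V → V → Prop :=
  ReflTransGen fun a b => b ∈ s a

theorem exists_connIn_iff_reaches (s : V → Finset V) (v u : V) :
    (∃ m, connIn s m v u) ↔ Reaches s v u := by
  constructor
  · rintro ⟨m, hm⟩
    induction m generalizing v with
    | zero => exact hm ▸ ReflTransGen.refl
    | succ m ih =>
      rcases hm with rfl | ⟨w, hw, hwu⟩
      · exact ReflTransGen.refl
      · exact ReflTransGen.head hw (ih w hwu)
  · intro h
    induction h using ReflTransGen.head_induction_on with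
    | refl => exact ⟨0, rfl⟩
    | head hab _ ih =>
      obtain ⟨m, hm⟩ := ih
      exact ⟨m + 1, Or.inr ⟨_, hab, hm⟩⟩

theorem distW_of_not_reaches {s : V → Finset V} {v u : V} (M : ℕ) (h : ¬ Reaches s v u) :
    distW s M v u = M := by
  rw [← exists_connIn_iff_reaches] at h
  simp [distW, h]

/-- `IsDist s d v u` : the hop distance from `v` to `u` is finite and equal to `d`. -/
def IsDist (s : V → Finset V) (d : ℕ) (v u : V) : Prop :=
  connIn s d v u ∧ ∀ e < d, ¬ connIn s e v u

theorem isDist_distW {s : V → Finset V} {v u : V} (M : ℕ) (h : Reaches s v u) :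
    IsDist s (distW s M v u) v u := by
  classical
  rw [← exists_connIn_iff_reaches] at h
  rw [distW, dif_pos h]
  exact ⟨Nat.find_spec h, fun e he => Nat.find_min h he⟩

theorem IsDist.unique {s : V → Finset V} {d e : ℕ} {v u : V} (hd : IsDist s d v u)
    (he : IsDist s e v u) : d = e := by
  rcases lt_trichotomy d e with h | h | h
  · exact absurd hd.1 (he.2 d h)
  · exact h
  · exact absurd he.1 (hd.2 e h)

theorem IsDist.exists_pred {s : V → Finset V} {d : ℕ} {v u : V} (h : IsDist s (d + 1) v u) :
    ∃ w, IsDist s d w u := by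
  rcases h.1 with rfl | ⟨w, hw, hwu⟩
  · exact absurd rfl (h.2 0 d.succ_pos)
  · exact ⟨w, hwu, fun e he hc => h.2 (e + 1) (by omega) (Or.inr ⟨w, hw, hc⟩)⟩

theorem IsDist.exists_of_le {s : V → Finset V} {d i : ℕ} {v u : V} (h : IsDist s d v u)
    (hi : i ≤ d) : ∃ w, IsDist s i w u := by
  induction d generalizing v with
  | zero => exact ⟨v, by rwa [Nat.le_zero.mp hi]⟩
  | succ d ih =>
    rcases hi.eq_or_lt with rfl | hlt
    · exact ⟨v, h⟩
    · obtain ⟨w, hw⟩ := h.exists_pred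
      exact ih hw (by omega)

theorem IsDist.lt_card [Fintype V] {s : V → Finset V} {d : ℕ} {v u : V}
    (h : IsDist s d v u) : d < Fintype.card V := by
  have hex : ∀ i : Fin (d + 1), ∃ w, IsDist s i w u := fun i => h.exists_of_le (by omega)
  choose f hf using hex
  have hinj : Function.Injective f := fun i j hij =>
    Fin.ext ((hf i).unique (hij ▸ hf j))
  simpa using Fintype.card_le_of_injective f hinj

open Classical in
/-- The set of nodes to which `v` has a directed path. -/
noncomputable def reachSet [Fintype V] (s : V → Finset V) (v : V) : Finset V :=
  Finset.univ.filter (Reaches s v)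

theorem mem_reachSet [Fintype V] {s : V → Finset V} {v u : V} :
    u ∈ reachSet s v ↔ Reaches s v u := by
  simp [reachSet]

theorem card_compl_reachSet_mul_le_cost [Fintype V] (s : V → Finset V) (M : ℕ) (v : V) :
    (reachSet s v)ᶜ.card * M ≤ cost s M v := by
  have hsub : (reachSet s v)ᶜ ⊆ Finset.univ.filter (fun u => u ≠ v) := by
    intro u hu
    rw [Finset.mem_compl, mem_reachSet] at hu
    simp only [Finset.mem_filter, Finset.mem_univ, true_and]
    rintro rfl
    exact hu ReflTransGen.refl
  calc (reachSet s v)ᶜ.card * M = ∑ u ∈ (reachSet s v)ᶜ, distW s M v u := by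
        rw [← smul_eq_mul, ← Finset.sum_const]
        refine Finset.sum_congr rfl fun u hu => ?_
        rw [Finset.mem_compl, mem_reachSet] at hu
        exact (distW_of_not_reaches M hu).symm
    _ ≤ cost s M v := Finset.sum_le_sum_of_subset hsub

theorem cost_le [Fintype V] (s : V → Finset V) (M : ℕ) (v : V) :
    cost s M v ≤ Fintype.card V ^ 2 + (reachSet s v)ᶜ.card * M := by
  calc cost s M v ≤ ∑ u, distW s M v u :=
        Finset.sum_le_sum_of_subset (Finset.subset_univ _)
    _ = ∑ u ∈ reachSet s v, distW s M v u + ∑ u ∈ (reachSet s v)ᶜ, distW s M v u :=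
        (Finset.sum_add_sum_compl _ _).symm
    _ ≤ (reachSet s v).card • Fintype.card V + (reachSet s v)ᶜ.card • M := by
        refine add_le_add (Finset.sum_le_card_nsmul _ _ _ fun u hu => ?_)
          (Finset.sum_le_card_nsmul _ _ _ fun u hu => ?_)
        · exact (isDist_distW M (mem_reachSet.mp hu)).lt_card.le
        · rw [Finset.mem_compl, mem_reachSet] at hu
          exact (distW_of_not_reaches M hu).le
    _ ≤ Fintype.card V ^ 2 + (reachSet s v)ᶜ.card * M := by
        rw [smul_eq_mul, smul_eq_mul, sq]
        gcongr
        exact Finset.card_le_univ _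

theorem Stable.card_reachSet_update_le [Fintype V] {k M : ℕ} {s : V → Finset V}
    (hs : Stable k M s) (hM : Fintype.card V ^ 2 < M) {v : V} {t : Finset V}
    (hv : v ∉ t) (ht : t.card ≤ k) :
    (reachSet (Function.update s v t) v).card ≤ (reachSet s v).card := by
  have hle := (card_compl_reachSet_mul_le_cost s M v).trans
    ((hs v t hv ht).trans (cost_le _ M v))
  have hlt : (reachSet s v)ᶜ.card * M <
      ((reachSet (Function.update s v t) v)ᶜ.card + 1) * M := by
    rw [add_mul]
    omega
  have hcard := Nat.lt_of_mul_lt_mul_right hlt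
  have h₁ := Finset.card_add_card_compl (reachSet s v)
  have h₂ := Finset.card_add_card_compl (reachSet (Function.update s v t) v)
  omega

/-- In a stable wiring no rewiring of `v` can keep everything `v` reaches and reach a new node. -/
theorem Stable.not_reaches_update [Fintype V] {k M : ℕ} {s : V → Finset V}
    (hs : Stable k M s) (hM : Fintype.card V ^ 2 < M) {v u : V} {t : Finset V}
    (hv : v ∉ t) (ht : t.card ≤ k) (hu : ¬ Reaches s v u)
    (hkeep : ∀ x, Reaches s v x → Reaches (Function.update s v t) v x) :
    ¬ Reaches (Function.update s v t) v u := by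
  intro hnew
  refine (hs.card_reachSet_update_le hM hv ht).not_gt (Finset.card_lt_card ?_)
  refine (Finset.ssubset_iff_of_subset fun x hx => ?_).mpr
    ⟨u, mem_reachSet.mpr hnew, fun h => hu (mem_reachSet.mp h)⟩
  exact mem_reachSet.mpr (hkeep x (mem_reachSet.mp hx))

theorem Reaches.update_of_not_reaches {s : V → Finset V} {v b x : V} (t : Finset V)
    (hv : ¬ Reaches s b v) (hx : Reaches s b x) : Reaches (Function.update s v t) b x := by
  induction hx with
  | refl => exact ReflTransGen.refl
  | @tail y z hby hyz ih =>
    refine ih.tail ?_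
    rw [Function.update_of_ne]
    · exact hyz
    · rintro rfl
      exact hv hby

theorem Reaches.exists_crossing {s : V → Finset V} {b v : V} (A : Set V)
    (h : Reaches s b v) (hb : b ∉ A) (hv : v ∈ A) :
    ∃ u a, u ∉ A ∧ a ∈ A ∧ a ∈ s u := by
  induction h with
  | refl => exact absurd hv hb
  | @tail y z _ hyz ih =>
    by_cases hy : y ∈ A
    · exact ih hy
    · exact ⟨y, z, hy, hv, hyz⟩

/-- In a stable wiring, a strongly connected set closed under reachability has no incoming edge. -/
theorem Stable.not_mem_of_closed [Fintype V] {k M : ℕ} {s : V → Finset V}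
    (hs : Stable k M s) (hw : IsWiring k s) (hk : 1 ≤ k) (hM : Fintype.card V ^ 2 < M)
    {u a : V} (hu : ¬ Reaches s a u) (hback : ∀ w, Reaches s a w → Reaches s w a) :
    a ∉ s u := by
  intro hau
  by_cases hpred : ∃ p, Reaches s a p ∧ a ∈ s p
  · obtain ⟨p, hap, hpa⟩ := hpred
    have hup : u ≠ p := by
      rintro rfl
      exact hu hap
    have hpu : ¬ Reaches s p u := fun h => hu (hap.trans h)
    have hcard : (insert u ((s p).erase a)).card ≤ k := by
      have h₁ := Finset.card_insert_le u ((s p).erase a)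
      have h₂ := Finset.card_erase_add_one hpa
      have h₃ := (hw p).2
      omega
    have hnot : p ∉ insert u ((s p).erase a) := by
      simp [hup.symm, (hw p).1]
    have hnew : Reaches (Function.update s p (insert u ((s p).erase a))) p u :=
      ReflTransGen.single (by simp)
    refine hs.not_reaches_update hM hnot hcard hpu (fun x hx => ?_) hnew
    induction hx with
    | refl => exact ReflTransGen.refl
    | @tail y z _ hyz ih =>
      by_cases hyp : y = p
      · subst hyp
        by_cases hza : z = a
        · subst hza
          exact hnew.tail (by rwa [Function.update_of_ne hup])
        · exact ih.tail (by simp [hza, hyz])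
      · exact ih.tail (by rwa [Function.update_of_ne hyp])
  · have hempty : ∀ w, w ∉ s a := by
      intro w hwa
      have haw : Reaches s a w := ReflTransGen.single hwa
      rcases ReflTransGen.cases_tail (hback w haw) with rfl | ⟨p, hwp, hpa⟩
      · exact (hw _).1 hwa
      · exact hpred ⟨p, haw.trans hwp, hpa⟩
    have hne : a ≠ u := by
      rintro rfl
      exact hu ReflTransGen.refl
    refine hs.not_reaches_update hM (t := {u}) (by simpa using hne) (by simpa using hk) hu
      (fun x hx => ?_) (ReflTransGen.single (by simp))
    rcases ReflTransGen.cases_head hx with rfl | ⟨w, hwa, _⟩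
    · exact ReflTransGen.refl
    · exact absurd hwa (hempty w)

theorem Stable.stronglyConnected [Fintype V] {k M : ℕ} {s : V → Finset V}
    (hs : Stable k M s) (hw : IsWiring k s) (hk : 1 ≤ k) (hM : Fintype.card V ^ 2 < M) :
    StronglyConnected s := by
  intro x y
  rw [exists_connIn_iff_reaches]
  obtain ⟨v, -, hmin⟩ := Finset.exists_min_image Finset.univ (fun v => (reachSet s v).card)
    ⟨x, Finset.mem_univ x⟩
  have hback : ∀ w, Reaches s v w → Reaches s w v := by
    intro w hvw
    have hsub : reachSet s w ⊆ reachSet s v := fun z hz =>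
      mem_reachSet.mpr (hvw.trans (mem_reachSet.mp hz))
    rw [← mem_reachSet, Finset.eq_of_subset_of_card_le hsub (hmin w (Finset.mem_univ w))]
    exact mem_reachSet.mpr ReflTransGen.refl
  have hall : ∀ b, Reaches s v b := by
    intro b
    by_contra hvb
    by_cases hbv : Reaches s b v
    · obtain ⟨u, a, hu, ha, hau⟩ := hbv.exists_crossing {w | Reaches s v w} hvb ReflTransGen.refl
      exact hs.not_mem_of_closed hw hk hM (fun h => hu (ReflTransGen.trans ha h))
        (fun w haw => (hback w (ReflTransGen.trans ha haw)).trans ha) hau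
    · have hne : v ≠ b := by
        rintro rfl
        exact hvb ReflTransGen.refl
      refine (hs.card_reachSet_update_le hM (v := v) (t := {b}) (by simpa using hne)
        (by simpa using hk)).not_gt
        ((hmin b (Finset.mem_univ b)).trans_lt (Finset.card_lt_card ?_))
      refine (Finset.ssubset_iff_of_subset fun z hz => ?_).mpr
        ⟨v, mem_reachSet.mpr ReflTransGen.refl, fun h => hbv (mem_reachSet.mp h)⟩
      exact mem_reachSet.mpr (ReflTransGen.head (by simp)
        (Reaches.update_of_not_reaches {b} hbv (mem_reachSet.mp hz)))
  have hmax : reachSet s x = Finset.univ := by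
    refine (Finset.card_eq_iff_eq_univ _).mp (le_antisymm (Finset.card_le_univ _) ?_)
    rw [← Finset.card_univ, ← Finset.eq_univ_iff_forall.mpr fun b => mem_reachSet.mpr (hall b)]
    exact hmin x (Finset.mem_univ x)
  rw [← mem_reachSet, hmax]
  exact Finset.mem_univ y

/-- With disconnection penalty `M > n²`, every stable wiring for the uniform
`(n,k)`-BDNF game is strongly connected. -/
theorem stmt_16 :
    ∀ n : ℕ, 2 ≤ n → ∀ k : ℕ, 1 ≤ k → k < n → ∀ M : ℕ, n ^ 2 < M →
      ∀ s : Fin n → Finset (Fin n), IsWiring k s → Stable k M s →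
        StronglyConnected s := by
  intro n _ k hk _ M hM s hw hs
  exact hs.stronglyConnected hw hk (by simpa using hM)

end BDNF
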